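/- arXiv:1502.00755 — 2 statements merged into one kernel-verified Lean document; each statement's English description precedes it below -/
import Mathlib

section
/- Let X be a separable metric space equipped with its Borel σ-algebra, and let f : X → [0,∞] be a Borel measurable extended function. Then the map P(X) → [0,∞] defined by λ ↦ ∫_X f dλ (lower Lebesgue integral) is Borel measurable, where P(X) carries the weak topology and its Borel σ-algebra. -/
open MeasureTheory
open scoped ENNReal

/-- A weakly continuous family of probability measures is measurable as a family of measures. -/
lemma Continuous.measurable_toMeasure {β X : Type*} [TopologicalSpace β] [MeasurableSpace β]
    [OpensMeasurableSpace β] [TopologicalSpace X] [HasOuterApproxClosed X] [MeasurableSpace X]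
    [BorelSpace X] {g : β → ProbabilityMeasure X} (hg : Continuous g) :
    Measurable fun b => (g b : Measure X) := by
  refine Measurable.measure_of_isPiSystem_of_isProbabilityMeasure
    BorelSpace.measurable_eq isPiSystem_isOpen fun U hU => ?_
  refine LowerSemicontinuous.measurable (lowerSemicontinuous_iff_le_liminf.2 fun b => ?_)
  exact ProbabilityMeasure.le_liminf_measure_open_of_tendsto (hg.tendsto b) hU

/-- Let `X` be a separable metric space with its Borel σ-algebra, and let
`f : X → [0,∞]` be Borel measurable. Then the map `λ ↦ ∫ f dλ` from the space `P(X)` of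
Borel probability measures on `X` (with the weak topology and the associated Borel
σ-algebra) to `[0,∞]` is Borel measurable. -/
theorem stmt7 {X : Type*} [MetricSpace X] [TopologicalSpace.SeparableSpace X]
    [MeasurableSpace X] [BorelSpace X]
    (f : X → ℝ≥0∞) (hf : Measurable f) :
    letI : MeasurableSpace (ProbabilityMeasure X) := borel (ProbabilityMeasure X)
    Measurable fun lam : ProbabilityMeasure X => ∫⁻ x, f x ∂(lam : Measure X) := by
  let _ : MeasurableSpace (ProbabilityMeasure X) := borel (ProbabilityMeasure X)
  have : BorelSpace (ProbabilityMeasure X) := ⟨rfl⟩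
  exact (Measure.measurable_lintegral hf).comp continuous_id.measurable_toMeasure
end

section
/- Let X be a separable metric space with its Borel σ-algebra, let μ be a Borel probability measure on X, let β : X → P(X) be a Borel measurable map satisfying μ(Y) = ∫_X β_x(Y) dμ(x) for every Borel set Y ⊆ X, and let ν := μ ∘ β⁻¹ be the pushforward measure on P(X). Let f : X → ℝ be Borel measurable and μ-integrable. Then f is λ-integrable for ν-almost all λ ∈ P(X); the function I_f on P(X), defined by I_f(λ) := ∫_X f dλ when f is λ-integrable and I_f(λ) := 0 otherwise, is ν-integrable; and ∫_X f dμ = ∫_{P(X)} I_f(λ) dν(λ). -/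
open MeasureTheory
open scoped ENNReal

/-- For a (pseudo)metrizable space, the inclusion of `P(X)`, with the Borel σ-algebra of the weak
topology, into the Giry σ-algebra on all measures is measurable. -/
theorem measurable_probabilityMeasure_toMeasure {X : Type*} [TopologicalSpace X]
    [HasOuterApproxClosed X] [MeasurableSpace X] [BorelSpace X]
    [MeasurableSpace (ProbabilityMeasure X)] [OpensMeasurableSpace (ProbabilityMeasure X)] :
    Measurable fun lam : ProbabilityMeasure X => (lam : Measure X) := by
  refine Measurable.measure_of_isPiSystem_of_isProbabilityMeasure
    (S := {F | IsClosed F}) ?_ (fun _ hs _ ht _ => IsClosed.inter hs ht) fun F hF => ?_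
  · rw [BorelSpace.measurable_eq (α := X), borel_eq_generateFrom_isClosed]
  · have hF : IsClosed F := hF
    exact measurable_of_tendsto_metrizable
      (fun n => (ProbabilityMeasure.continuous_lintegral_boundedContinuousFunction
        (hF.apprSeq n)).measurable)
      (tendsto_pi_nhds.2 fun lam =>
        HasOuterApproxClosed.tendsto_lintegral_apprSeq hF (lam : Measure X))

/-- Disintegration of a Bochner integral along a composition of a measure and a kernel. -/
theorem integrable_integral_and_integral_eq_of_comp {α β E : Type*} [MeasurableSpace α]
    [MeasurableSpace β] [NormedAddCommGroup E] [NormedSpace ℝ E] {ν : Measure α}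
    {κ : ProbabilityTheory.Kernel α β} {f : β → E} (hf : Integrable f (ν.bind κ)) :
    (∀ᵐ a ∂ν, Integrable f (κ a)) ∧ Integrable (fun a => ∫ y, f y ∂(κ a)) ν ∧
      ∫ y, f y ∂(ν.bind κ) = ∫ a, (∫ y, f y ∂(κ a)) ∂ν := by
  refine ⟨Measure.ae_integrable_of_integrable_comp hf, ?_⟩
  rw [Measure.comp_eq_comp_const_apply] at hf ⊢
  exact ⟨by simpa using hf.integral_comp,
    by simpa using ProbabilityTheory.Kernel.integral_comp hf⟩

/-- Let `X` be a separable metric space with its Borel σ-algebra, `μ` a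
Borel probability measure on `X`, `β : X → P(X)` a Borel measurable map satisfying
`μ Y = ∫ β_x(Y) dμ(x)` for every Borel set `Y`, and `ν := μ ∘ β⁻¹` the pushforward measure
on `P(X)`. Let `f : X → ℝ` be Borel measurable and `μ`-integrable. Then `f` is
`λ`-integrable for `ν`-almost all `λ`; the function `I_f : λ ↦ ∫ f dλ` (set to `0` when `f`
is not `λ`-integrable, as is the convention of the Bochner integral) is `ν`-integrable; and
`∫_X f dμ = ∫_{P(X)} I_f(λ) dν(λ)`. -/
theorem stmt10 {X : Type*} [MetricSpace X] [TopologicalSpace.SeparableSpace X]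
    [MeasurableSpace X] [BorelSpace X]
    (μ : Measure X) [IsProbabilityMeasure μ]
    (β : X → ProbabilityMeasure X) :
    letI : MeasurableSpace (ProbabilityMeasure X) := borel (ProbabilityMeasure X)
    ∀ (hβ : Measurable β)
      (hbar : ∀ Y : Set X, MeasurableSet Y → μ Y = ∫⁻ x, (β x : Measure X) Y ∂μ)
      (f : X → ℝ), Measurable f → Integrable f μ →
      (∀ᵐ lam : ProbabilityMeasure X ∂(μ.map β), Integrable f (lam : Measure X)) ∧
      Integrable (fun lam : ProbabilityMeasure X => ∫ x, f x ∂(lam : Measure X)) (μ.map β) ∧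
      ∫ x, f x ∂μ =
        ∫ lam : ProbabilityMeasure X, (∫ x, f x ∂(lam : Measure X)) ∂(μ.map β) := by
  let : MeasurableSpace (ProbabilityMeasure X) := borel (ProbabilityMeasure X)
  have : BorelSpace (ProbabilityMeasure X) := ⟨rfl⟩
  intro hβ hbar f _ hfi
  have hm := measurable_probabilityMeasure_toMeasure (X := X)
  let κ : ProbabilityTheory.Kernel (ProbabilityMeasure X) X := ⟨_, hm⟩
  have hκ : (μ.map β).bind κ = μ := by
    ext Y hY
    rw [Measure.bind_apply hY κ.measurable.aemeasurable,
      lintegral_map (κ.measurable_coe hY) hβ, hbar Y hY]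
    rfl
  have h := integrable_integral_and_integral_eq_of_comp (hκ.symm ▸ hfi)
  rwa [hκ] at h
end
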